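/- Let ω₀ > 0, 0 < ε ≪ ω₀, M, k > 0, and suppose h : [-1,0] → ℝ is continuous with (-z)^{ε}|h(z)| ≤ k for all z. Let u, v ∈ C¹([-1,0]) with u(-1) = v(-1) = 0, and suppose m : [-1,0] → ℝ satisfies the pointwise bound |m(z)| ≤ ∫_{-1}^{z} ( |h(z')| (|u'(z')| + |v'(z')|) + |h(z')| |u(z')|/(z'+1) ) dz' for all z. Then for every ω with ω₀ ≤ ω ≤ 5, ∫_{-1}^{0} (-z)^{2ω-1} m(z)² dz ≤ C(ω₀) (k²/ε) ∫_{-1}^{0} (-z)^{2ω-2ε} ( u'(z)² + v'(z)² ) dz, where C(ω₀) depends only on ω₀. -/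

import Mathlib

open Set intervalIntegral MeasureTheory Topology in
/-- Weighted Hardy inequality for a primitive. -/
theorem aux_hardy_prim (ω : ℝ) (hω : 0 < ω) (g : ℝ → ℝ) (hg : ContinuousOn g (Icc (-1:ℝ) 0)) :
    ∫ z in (-1:ℝ)..0, (-z) ^ (2*ω - 1) * (∫ t in (-1:ℝ)..z, g t)^2 ≤
      (1 / ω^2) * ∫ z in (-1:ℝ)..0, (-z) ^ (2*ω + 1) * (g z)^2 := by
  have hle : (-1:ℝ) ≤ 0 := by norm_num
  have hgi : IntervalIntegrable g volume (-1) 0 := by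
    apply ContinuousOn.intervalIntegrable
    rwa [uIcc_of_le hle]
  set P : ℝ → ℝ := fun z => ∫ t in (-1:ℝ)..z, g t with hP
  have hPc : ContinuousOn P (Icc (-1:ℝ) 0) := by
    have := continuousOn_primitive_interval' hgi (left_mem_uIcc)
    rwa [uIcc_of_le hle] at this
  have hPd : ∀ z ∈ Ioo (-1:ℝ) 0, HasDerivAt P (g z) z := by
    intro z hz
    have hzn : Icc (-1:ℝ) 0 ∈ 𝓝 z := Icc_mem_nhds hz.1 hz.2
    apply integral_hasDerivAt_right
    · apply hgi.mono_set
      rw [uIcc_of_le hle, uIcc_of_le hz.1.le]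
      exact Icc_subset_Icc le_rfl hz.2.le
    · exact (hg.mono Ioo_subset_Icc_self).stronglyMeasurableAtFilter isOpen_Ioo z hz
    · exact hg.continuousAt hzn
  have hi1 : IntervalIntegrable (fun z : ℝ => (-z) ^ (2*ω - 1) * (P z)^2) volume (-1) 0 := by
    apply IntervalIntegrable.mul_continuousOn
    · have h0 : IntervalIntegrable (fun x : ℝ => x ^ (2*ω-1)) MeasureTheory.volume 1 0 :=
          intervalIntegral.intervalIntegrable_rpow' (by linarith)
      simpa using (IntervalIntegrable.iff_comp_neg).1 h0
    · rw [uIcc_of_le hle]; exact hPc.pow 2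
  have hi2 : IntervalIntegrable (fun z : ℝ => (-z) ^ (2*ω + 1) * (g z)^2) volume (-1) 0 := by
    apply ContinuousOn.intervalIntegrable
    rw [uIcc_of_le hle]
    exact (continuousOn_id.neg.rpow_const (fun _ _ => Or.inr (by linarith))).mul (hg.pow 2)
  have key := integral_le_sub_of_hasDeriv_right_of_le (a := -1) (b := 0)
    (g := fun z => -((-z) ^ (2*ω) * (P z)^2 / (2*ω)))
    (g' := fun z => (-z) ^ (2*ω-1) * (P z)^2 - (-z)^(2*ω) * (P z) * g z / ω)
    (φ := fun z => (1/2) * ((-z) ^ (2*ω - 1) * (P z)^2)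
      - (1 / (2*ω^2)) * ((-z) ^ (2*ω + 1) * (g z)^2)) hle ?_ ?_ ?_ ?_
  · rw [intervalIntegral.integral_sub (hi1.const_mul _) (hi2.const_mul _),
      intervalIntegral.integral_const_mul, intervalIntegral.integral_const_mul] at key
    have h0 : (0:ℝ) ^ (2*ω) = 0 := Real.zero_rpow (by linarith)
    have hP1 : P (-1) = 0 := by simp [hP]
    simp only [neg_zero, h0, hP1] at key
    have : (1 / (2*ω^2)) = (1/2) * (1/ω^2) := by field_simp
    rw [this, mul_assoc] at key
    have e0 : -(0 * P 0 ^ 2 / (2 * ω)) - -((- -1) ^ (2 * ω) * 0 ^ 2 / (2 * ω)) = 0 := by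
      simp
    rw [e0] at key
    change ∫ z in (-1:ℝ)..0, (-z) ^ (2*ω - 1) * (P z)^2 ≤ _
    linarith
  · exact (((continuousOn_id.neg.rpow_const (fun _ _ => Or.inr (by linarith))).mul
      (hPc.pow 2)).div_const _).neg
  · intro z hz
    have h1 : HasDerivAt (fun z : ℝ => (-z) ^ (2*ω)) (-1 * (2*ω) * (-z)^(2*ω-1)) z :=
      (hasDerivAt_neg z).rpow_const (Or.inl (by linarith [hz.2]))
    have h2 := (((h1.mul ((hPd z hz).pow 2)).div_const (2*ω)).neg).hasDerivWithinAt (s := Ioi z)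
    refine h2.congr_deriv ?_
    simp only [Pi.pow_apply]
    field_simp
    ring
  · have := (hi1.const_mul (1/2)).sub (hi2.const_mul (1 / (2*ω^2)))
    rw [intervalIntegrable_iff_integrableOn_Icc_of_le hle] at this
    exact this
  · intro z hz
    have hs : 0 < -z := by linarith [hz.2]
    have e1 : (-z)^(2*ω) = (-z)^(2*ω-1) * (-z) := by
      rw [← Real.rpow_add_one hs.ne']; ring_nf
    have e2 : (-z)^(2*ω+1) = (-z)^(2*ω-1) * (-z) * (-z) := by
      rw [← e1, ← Real.rpow_add_one hs.ne']
    have hW : 0 ≤ (-z)^(2*ω-1) := Real.rpow_nonneg hs.le _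
    rw [e1, e2]
    have := mul_nonneg hW (sq_nonneg (P z - (-z) * g z / ω))
    have e3 : (-z)^(2*ω-1) * (P z - (-z) * g z / ω)^2 / 2
        = ((-z) ^ (2*ω-1) * (P z)^2 - (-z)^(2*ω-1) * (-z) * (P z) * g z / ω)
        - ((1/2) * ((-z) ^ (2*ω - 1) * (P z)^2)
      - (1 / (2*ω^2)) * ((-z)^(2*ω-1) * (-z) * (-z) * (g z)^2)) := by
      field_simp
      ring
    linarith

open Set intervalIntegral MeasureTheory Topology in
/-- Weighted Hardy inequality at the left end point. -/
theorem aux_hardy_left (b : ℝ) (hb : 0 < b) (u u' q : ℝ → ℝ)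
    (hu : ∀ z ∈ Icc (-1:ℝ) 0, HasDerivWithinAt u (u' z) (Icc (-1:ℝ) 0) z)
    (hu' : ContinuousOn u' (Icc (-1:ℝ) 0)) (hq : ContinuousOn q (Icc (-1:ℝ) 0))
    (hqu : ∀ z ∈ Icc (-1:ℝ) 0, u z = q z * (z + 1)) :
    ∫ z in (-1:ℝ)..0, (-z) ^ b * (q z)^2 ≤
      4 * ∫ z in (-1:ℝ)..0, (-z) ^ b * (u' z)^2 := by
  have hle : (-1:ℝ) ≤ 0 := by norm_num
  have hw : ContinuousOn (fun z : ℝ => (-z)^b) (Icc (-1:ℝ) 0) :=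
    continuousOn_id.neg.rpow_const (fun _ _ => Or.inr hb.le)
  have huc : ContinuousOn u (Icc (-1:ℝ) 0) := fun z hz => (hu z hz).continuousWithinAt
  have hi1 : IntervalIntegrable (fun z : ℝ => (-z) ^ b * (q z)^2) volume (-1) 0 := by
    apply ContinuousOn.intervalIntegrable
    rw [uIcc_of_le hle]
    exact hw.mul (hq.pow 2)
  have hi2 : IntervalIntegrable (fun z : ℝ => (-z) ^ b * (u' z)^2) volume (-1) 0 := by
    apply ContinuousOn.intervalIntegrable
    rw [uIcc_of_le hle]
    exact hw.mul (hu'.pow 2)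
  have hqd : ∀ z ∈ Ioo (-1:ℝ) 0, HasDerivAt q ((u' z - q z) / (z+1)) z := by
    intro z hz
    have hzn : Icc (-1:ℝ) 0 ∈ 𝓝 z := Icc_mem_nhds hz.1 hz.2
    have hz1 : z + 1 ≠ 0 := by linarith [hz.1]
    have h1 := (hu z (Ioo_subset_Icc_self hz)).hasDerivAt hzn
    have h2 := h1.div ((hasDerivAt_id z).add_const 1) hz1
    have h3 : q =ᶠ[𝓝 z] (u / fun x => id x + 1) := by
      filter_upwards [Ioo_mem_nhds hz.1 hz.2] with x hx
      have : x + 1 ≠ 0 := by linarith [hx.1]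
      simp only [Pi.div_apply, id]
      rw [hqu x (Ioo_subset_Icc_self hx)]
      field_simp
    refine (h2.congr_of_eventuallyEq h3).congr_deriv ?_
    simp only [id]
    rw [hqu z (Ioo_subset_Icc_self hz)]
    field_simp
  have key := integral_le_sub_of_hasDeriv_right_of_le (a := -1) (b := 0)
    (g := fun z => -((-z) ^ b * (u z * q z)))
    (g' := fun z => b * (-z) ^ (b-1) * ((q z)^2 * (z+1))
      - (-z)^b * (2 * u' z * q z - (q z)^2))
    (φ := fun z => (1/2) * ((-z) ^ b * (q z)^2)
      - 2 * ((-z) ^ b * (u' z)^2)) hle ?_ ?_ ?_ ?_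
  · rw [intervalIntegral.integral_sub (hi1.const_mul _) (hi2.const_mul _),
      intervalIntegral.integral_const_mul, intervalIntegral.integral_const_mul] at key
    have h0 : (0:ℝ) ^ b = 0 := Real.zero_rpow hb.ne'
    have hu1 : u (-1) = 0 := by rw [hqu (-1) (by simp)]; simp
    simp only [neg_zero, h0, hu1] at key
    linarith
  · exact (hw.mul (huc.mul hq)).neg
  · intro z hz
    have hzn : Icc (-1:ℝ) 0 ∈ 𝓝 z := Icc_mem_nhds hz.1 hz.2
    have hz1 : z + 1 ≠ 0 := by linarith [hz.1]
    have h1 : HasDerivAt (fun z : ℝ => (-z) ^ b) (-1 * b * (-z)^(b-1)) z :=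
      (hasDerivAt_neg z).rpow_const (Or.inl (by linarith [hz.2]))
    have h2 := ((h1.mul (((hu z (Ioo_subset_Icc_self hz)).hasDerivAt hzn).mul
      (hqd z hz))).neg).hasDerivWithinAt (s := Ioi z)
    refine h2.congr_deriv ?_
    simp only [Pi.mul_apply]
    rw [hqu z (Ioo_subset_Icc_self hz)]
    field_simp
    ring
  · have := (hi1.const_mul (1/2)).sub (hi2.const_mul 2)
    rw [intervalIntegrable_iff_integrableOn_Icc_of_le hle] at this
    exact this
  · intro z hz
    have hs : 0 < -z := by linarith [hz.2]
    have hz1 : 0 < z + 1 := by linarith [hz.1]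
    have hW : 0 ≤ (-z)^b := Real.rpow_nonneg hs.le _
    have hW1 : 0 ≤ b * (-z)^(b-1) * ((q z)^2 * (z+1)) := by positivity
    have := mul_nonneg hW (sq_nonneg (q z - 2 * u' z))
    nlinarith


/-- no-derivative-loss weighted estimate: there is a constant `C = C(ω₀)` such
that whenever `(-z)^ε |h| ≤ k`, `u, v ∈ C¹` vanish at `-1`, and
`|m(z)| ≤ ∫_{-1}^z ( |h|(|u'|+|v'|) + |h||u|/(z'+1) )`, then for all `ω ∈ [ω₀, 5]`,
`∫_{-1}^0 (-z)^{2ω-1} m² ≤ C (k²/ε) ∫_{-1}^0 (-z)^{2ω-2ε} (u'² + v'²)`. -/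
theorem stmt_17 (ω₀ : ℝ) (hω₀ : 0 < ω₀) :
    ∃ C : ℝ, 0 < C ∧
      ∀ (ε k M : ℝ), 0 < ε → ε < ω₀ → 0 < k → 0 < M →
        ∀ (h u v u' v' m : ℝ → ℝ),
          ContinuousOn h (Set.Icc (-1:ℝ) 0) →
          (∀ z ∈ Set.Icc (-1:ℝ) 0, (-z) ^ ε * |h z| ≤ k) →
          (∀ z ∈ Set.Icc (-1:ℝ) 0, HasDerivWithinAt u (u' z) (Set.Icc (-1:ℝ) 0) z) →
          (∀ z ∈ Set.Icc (-1:ℝ) 0, HasDerivWithinAt v (v' z) (Set.Icc (-1:ℝ) 0) z) →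
          ContinuousOn u' (Set.Icc (-1:ℝ) 0) →
          ContinuousOn v' (Set.Icc (-1:ℝ) 0) →
          u (-1) = 0 → v (-1) = 0 →
          (∀ z ∈ Set.Icc (-1:ℝ) 0, |m z| ≤
            ∫ z' in (-1:ℝ)..z,
              (|h z'| * (|u' z'| + |v' z'|) + |h z'| * |u z'| / (z' + 1))) →
          ∀ ω : ℝ, ω₀ ≤ ω → ω ≤ 5 →
            ∫ z in (-1:ℝ)..0, (-z) ^ (2*ω - 1) * (m z)^2 ≤
              C * (k^2 / ε) *
                ∫ z in (-1:ℝ)..0, (-z) ^ (2*ω - 2*ε) * ((u' z)^2 + (v' z)^2) := by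
  have hle : (-1:ℝ) ≤ 0 := by norm_num
  refine ⟨15 / ω₀, by positivity, ?_⟩
  intro ε k M hε hεω hk hM h u v u' v' m hh hhk hu hv hu' hv' hu1 hv1 hm ω hω hω5
  have hωp : 0 < ω := by linarith
  -- the quotient `u / (z+1)`, extended continuously
  obtain ⟨q, hq, hqu⟩ : ∃ q : ℝ → ℝ, ContinuousOn q (Set.Icc (-1:ℝ) 0) ∧
      ∀ z ∈ Set.Icc (-1:ℝ) 0, u z = q z * (z + 1) := by
    refine ⟨Function.update (fun z => u z / (z+1)) (-1) (u' (-1)), ?_, ?_⟩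
    · intro z hz
      by_cases hz1 : z = -1
      · subst hz1
        rw [continuousWithinAt_update_same]
        have h1 := hasDerivWithinAt_iff_tendsto_slope.1 (hu (-1) hz)
        refine h1.congr fun x => ?_
        rw [slope_def_field, hu1]
        simp
      · rw [continuousWithinAt_update_of_ne hz1]
        apply (hu z hz).continuousWithinAt.div
        · fun_prop
        · intro h0; exact hz1 (by linarith)
    · intro z hz
      by_cases hz1 : z = -1
      · subst hz1; simp [hu1]
      · rw [Function.update_of_ne hz1]
        have : z + 1 ≠ 0 := fun h0 => hz1 (by linarith)
        field_simp
  set g : ℝ → ℝ := fun z => |h z| * (|u' z| + |v' z| + |q z|) with hgdef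
  have hg : ContinuousOn g (Set.Icc (-1:ℝ) 0) :=
    hh.abs.mul ((hu'.abs.add hv'.abs).add hq.abs)
  have hm' : ∀ z ∈ Set.Icc (-1:ℝ) 0, |m z| ≤ ∫ t in (-1:ℝ)..z, g t := by
    intro z hz
    refine (hm z hz).trans (le_of_eq ?_)
    apply intervalIntegral.integral_congr_ae
    refine Filter.Eventually.of_forall fun x hx => ?_
    rw [Set.uIoc_of_le hz.1] at hx
    have hx1 : 0 < x + 1 := by linarith [hx.1]
    rw [hqu x ⟨hx.1.le, hx.2.trans hz.2⟩, abs_mul, abs_of_pos hx1]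
    simp only [hgdef]
    field_simp
  have hgi : IntervalIntegrable g MeasureTheory.volume (-1) 0 := by
    apply ContinuousOn.intervalIntegrable
    rwa [Set.uIcc_of_le hle]
  have hPc : ContinuousOn (fun z => ∫ t in (-1:ℝ)..z, g t) (Set.Icc (-1:ℝ) 0) := by
    have := intervalIntegral.continuousOn_primitive_interval' hgi (Set.left_mem_uIcc)
    rwa [Set.uIcc_of_le hle] at this
  have hb : 0 < 2*ω - 2*ε := by linarith
  have hw : ∀ b : ℝ, 0 ≤ b → ContinuousOn (fun z : ℝ => (-z)^b) (Set.Icc (-1:ℝ) 0) :=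
    fun b hb => continuousOn_id.neg.rpow_const (fun _ _ => Or.inr hb)
  have hint : ∀ f : ℝ → ℝ, ContinuousOn f (Set.Icc (-1:ℝ) 0) →
      IntervalIntegrable f MeasureTheory.volume (-1) 0 := by
    intro f hf
    apply ContinuousOn.intervalIntegrable
    rwa [Set.uIcc_of_le hle]
  have iu := hint (fun z => (-z) ^ (2*ω - 2*ε) * (u' z)^2) ((hw _ hb.le).mul (hu'.pow 2))
  have iv := hint (fun z => (-z) ^ (2*ω - 2*ε) * (v' z)^2) ((hw _ hb.le).mul (hv'.pow 2))
  have iq := hint (fun z => (-z) ^ (2*ω - 2*ε) * (q z)^2) ((hw _ hb.le).mul (hq.pow 2))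
  have huv0 : ∀ f : ℝ → ℝ, 0 ≤ ∫ z in (-1:ℝ)..0, (-z) ^ (2*ω - 2*ε) * (f z)^2 := by
    intro f
    apply intervalIntegral.integral_nonneg hle
    intro z hz
    have := Real.rpow_nonneg (show 0 ≤ -z by linarith [hz.2]) (2*ω - 2*ε)
    positivity
  have hsplit : ∫ z in (-1:ℝ)..0, (-z) ^ (2*ω - 2*ε) * ((u' z)^2 + (v' z)^2)
      = (∫ z in (-1:ℝ)..0, (-z) ^ (2*ω - 2*ε) * (u' z)^2)
        + ∫ z in (-1:ℝ)..0, (-z) ^ (2*ω - 2*ε) * (v' z)^2 := by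
    rw [← intervalIntegral.integral_add iu iv]
    simp only [mul_add]
  have H2 := aux_hardy_left (2*ω - 2*ε) hb u u' q hu hu' hq hqu
  have H1 := aux_hardy_prim ω hωp g hg
  -- step 1: replace `m` by the primitive
  have S1 : ∫ z in (-1:ℝ)..0, (-z) ^ (2*ω - 1) * (m z)^2 ≤
      ∫ z in (-1:ℝ)..0, (-z) ^ (2*ω - 1) * (∫ t in (-1:ℝ)..z, g t)^2 := by
    have hi1 : IntervalIntegrable
        (fun z : ℝ => (-z) ^ (2*ω - 1) * (∫ t in (-1:ℝ)..z, g t)^2)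
        MeasureTheory.volume (-1) 0 := by
      apply IntervalIntegrable.mul_continuousOn
      · have h0 : IntervalIntegrable (fun x : ℝ => x ^ (2*ω-1)) MeasureTheory.volume 1 0 :=
          intervalIntegral.intervalIntegrable_rpow' (by linarith)
        simpa using (IntervalIntegrable.iff_comp_neg).1 h0
      · rw [Set.uIcc_of_le hle]; exact hPc.pow 2
    by_cases hi : IntervalIntegrable (fun z : ℝ => (-z) ^ (2*ω - 1) * (m z)^2)
        MeasureTheory.volume (-1) 0
    · apply intervalIntegral.integral_mono_on hle hi hi1
      intro z hz
      apply mul_le_mul_of_nonneg_left _ (Real.rpow_nonneg (by linarith [hz.2]) _)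
      rw [← sq_abs]
      exact pow_le_pow_left₀ (abs_nonneg _) (hm' z hz) 2
    · rw [intervalIntegral.integral_undef hi]
      apply intervalIntegral.integral_nonneg hle
      intro z hz
      exact mul_nonneg (Real.rpow_nonneg (by linarith [hz.2]) _) (sq_nonneg _)
  -- step 2: use the bound on `h`
  have S2 : ∫ z in (-1:ℝ)..0, (-z) ^ (2*ω + 1) * (g z)^2 ≤
      3 * k^2 * ((∫ z in (-1:ℝ)..0, (-z) ^ (2*ω - 2*ε) * (u' z)^2)
        + (∫ z in (-1:ℝ)..0, (-z) ^ (2*ω - 2*ε) * (v' z)^2)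
        + ∫ z in (-1:ℝ)..0, (-z) ^ (2*ω - 2*ε) * (q z)^2) := by
    rw [← intervalIntegral.integral_add iu iv, ← intervalIntegral.integral_add (iu.add iv) iq,
      ← intervalIntegral.integral_const_mul]
    apply intervalIntegral.integral_mono_on hle
    · exact hint _ ((hw _ (by linarith)).mul (hg.pow 2))
    · exact ((iu.add iv).add iq).const_mul _
    intro z hz
    have hs : 0 ≤ -z := by linarith [hz.2]
    have hs1 : -z ≤ 1 := by linarith [hz.1]
    have e1 : (-z)^(2*ω+1) = (-z)^(2*ω-2*ε) * ((-z)^ε * (-z)^ε) * (-z) := by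
      rw [← Real.rpow_add_of_nonneg hs hε.le hε.le, ← Real.rpow_add_of_nonneg hs hb.le (by linarith)]
      rw [Real.rpow_add_of_nonneg hs (by linarith) zero_le_one, Real.rpow_one]
      ring_nf
    have hW : 0 ≤ (-z)^(2*ω-2*ε) := Real.rpow_nonneg hs _
    have hE : 0 ≤ (-z)^ε * |h z| := mul_nonneg (Real.rpow_nonneg hs _) (abs_nonneg _)
    have hE2 : ((-z)^ε * |h z|)^2 ≤ k^2 := pow_le_pow_left₀ hE (hhk z hz) 2
    have hφ : (|u' z| + |v' z| + |q z|)^2 ≤ 3 * ((u' z)^2 + (v' z)^2 + (q z)^2) := by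
      rw [← sq_abs (u' z), ← sq_abs (v' z), ← sq_abs (q z)]
      nlinarith [sq_nonneg (|u' z| - |v' z|), sq_nonneg (|u' z| - |q z|),
        sq_nonneg (|v' z| - |q z|)]
    calc (-z) ^ (2*ω + 1) * (g z)^2
        = (-z) * ((-z)^(2*ω-2*ε) * (((-z)^ε * |h z|)^2 * (|u' z| + |v' z| + |q z|)^2)) := by
          rw [e1]; simp only [hgdef]; ring
      _ ≤ 1 * ((-z)^(2*ω-2*ε) * (((-z)^ε * |h z|)^2 * (|u' z| + |v' z| + |q z|)^2)) := by
          apply mul_le_mul_of_nonneg_right hs1; positivity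
      _ ≤ 1 * ((-z)^(2*ω-2*ε) * (k^2 * (3 * ((u' z)^2 + (v' z)^2 + (q z)^2)))) := by
          gcongr
      _ = _ := by ring
  rw [hsplit]
  set U := ∫ z in (-1:ℝ)..0, (-z) ^ (2*ω - 2*ε) * (u' z)^2
  set V := ∫ z in (-1:ℝ)..0, (-z) ^ (2*ω - 2*ε) * (v' z)^2
  have hU : 0 ≤ U := huv0 u'
  have hV : 0 ≤ V := huv0 v'
  have hc : 1 / ω^2 ≤ 1 / (ω₀ * ε) := by
    apply one_div_le_one_div_of_le (by positivity)
    nlinarith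
  calc _ ≤ _ := S1
    _ ≤ _ := H1
    _ ≤ 1 / ω^2 * (15 * k^2 * (U + V)) := by
        apply mul_le_mul_of_nonneg_left _ (by positivity)
        refine S2.trans ?_
        have : 0 ≤ k^2 := by positivity
        nlinarith [mul_le_mul_of_nonneg_left H2 this, mul_nonneg this hV]
    _ ≤ 1 / (ω₀ * ε) * (15 * k^2 * (U + V)) := by
        apply mul_le_mul_of_nonneg_right hc; positivity
    _ = 15 / ω₀ * (k^2 / ε) * (U + V) := by
        field_simp
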